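/- Two finite ultrametric spaces X and Y are indistinguishable (i.e., d_GH(λΔₙ,X) = d_GH(λΔₙ,Y) for all n ≥ 1 and λ ≥ 0) if and only if #X = #Y and σ(X) = σ(Y). -/

import Mathlib

/-- `Δ` is a simplex of cardinality `n` and non-zero distance `l`. -/
def IsSimplexOf (Δ : Type) [MetricSpace Δ] [Fintype Δ] (n : ℕ) (l : ℝ) : Prop :=
  Fintype.card Δ = n ∧ ∀ x y : Δ, x ≠ y → dist x y = l

/-- The multiset of edge lengths of a graph `G` on a finite metric space `V`. -/
noncomputable def edgeLengths {V : Type} [MetricSpace V] [Fintype V] (G : SimpleGraph V) :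
    Multiset ℝ :=
  (G.edgeSet.toFinite.toFinset).val.map
    (Sym2.lift ⟨fun x y => dist x y, fun _ _ => dist_comm _ _⟩)

/-- The length of a graph `G` on a finite metric space: the sum of the lengths of its edges. -/
noncomputable def graphLength {V : Type} [MetricSpace V] [Fintype V] (G : SimpleGraph V) : ℝ :=
  (edgeLengths G).sum

/-- `G` is a minimal spanning tree on the finite metric space `V`: a tree with vertex set `V`
whose length is minimal among all such trees. -/
def IsMST {V : Type} [MetricSpace V] [Fintype V] (G : SimpleGraph V) : Prop :=
  G.IsTree ∧ ∀ H : SimpleGraph V, H.IsTree → graphLength G ≤ graphLength H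


section Helpers

open GromovHausdorff

/-- number of classes of the relation `dist ≤ t` -/
noncomputable def numCl (X : Type) [MetricSpace X] (t : ℝ) : ℕ :=
  Nat.card (Quot (fun x y : X => dist x y ≤ t))

/-- the ultrametric inequality -/
def Ultra (X : Type) [MetricSpace X] : Prop :=
  ∀ x y z : X, dist x z ≤ max (dist x y) (dist y z)

lemma quot_eq {X : Type} [MetricSpace X] (h : Ultra X) {t : ℝ} (ht : 0 ≤ t) (x y : X) :
    Quot.mk (fun x y : X => dist x y ≤ t) x = Quot.mk _ y ↔ dist x y ≤ t := by
  have he : Equivalence (fun x y : X => dist x y ≤ t) :=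
    ⟨fun x => by simpa using ht, fun {x y} hxy => by rwa [dist_comm],
      fun {x y z} h1 h2 => (h x y z).trans (max_le h1 h2)⟩
  rw [Quot.eq, he.eqvGen_iff]

lemma numCl_zero {X : Type} [MetricSpace X] [Fintype X] (h : Ultra X) :
    numCl X 0 = Fintype.card X := by
  rw [numCl, ← Nat.card_eq_fintype_card]
  symm
  apply Nat.card_eq_of_bijective (Quot.mk _)
  refine ⟨fun x y hxy => ?_, Quot.mk_surjective⟩
  rw [quot_eq h le_rfl] at hxy
  exact dist_le_zero.mp hxy

lemma numCl_pos {X : Type} [MetricSpace X] [Fintype X] [Nonempty X] (t : ℝ) :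
    1 ≤ numCl X t := by
  have : Nonempty (Quot (fun x y : X => dist x y ≤ t)) := ⟨Quot.mk _ (Classical.arbitrary X)⟩
  exact Nat.card_pos

lemma numCl_anti {X : Type} [MetricSpace X] [Fintype X] {s t : ℝ} (hst : s ≤ t) :
    numCl X t ≤ numCl X s := by
  apply Nat.card_le_card_of_surjective
    (Quot.map id (fun x y (hxy : dist x y ≤ s) => hxy.trans hst))
  rintro ⟨x⟩
  exact ⟨Quot.mk _ x, rfl⟩

lemma numCl_le_one {X : Type} [MetricSpace X] [Fintype X] (h : Ultra X) {t : ℝ} (ht : 0 ≤ t) :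
    numCl X t ≤ 1 ↔ ∀ x y : X, dist x y ≤ t := by
  rw [numCl, Finite.card_le_one_iff_subsingleton]
  constructor
  · intro hs x y
    rw [← quot_eq h ht]
    exact Subsingleton.elim _ _
  · intro hs
    refine ⟨?_⟩
    rintro ⟨x⟩ ⟨y⟩
    exact Quot.sound (hs x y)

/-- The condition on class counts that characterizes `2 d_GH ≤ r`. -/
def Cond (N : ℝ → ℕ) (k : ℕ) (l r : ℝ) : Prop :=
  N (l + r) ≤ 1 ∧ N r ≤ k ∧ ∀ t, 0 ≤ t → t < l - r → k ≤ N t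

lemma exists_factor {A B D : Type} [Finite A] [Finite B] [Finite D] (g : A → B)
    (hg : Function.Surjective g) (h1 : Nat.card B ≤ Nat.card D) (h2 : Nat.card D ≤ Nat.card A) :
    ∃ φ : A → D, Function.Surjective φ ∧ ∀ a a', φ a = φ a' → g a = g a' := by
  classical
  have := Fintype.ofFinite A
  have := Fintype.ofFinite B
  have := Fintype.ofFinite D
  obtain ⟨s, hs⟩ := hg.hasRightInverse
  have hsi : Function.Injective s := hs.injective
  simp only [Nat.card_eq_fintype_card] at h1 h2
  obtain ⟨S, hS1, -, hS⟩ := Finset.exists_subsuperset_card_eq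
    (s := Finset.univ.image s) (t := Finset.univ) (n := Fintype.card D) (Finset.subset_univ _)
    (by rw [Finset.card_image_of_injective _ hsi]; simpa using h1) (by simpa using h2)
  have e : S ≃ D := Fintype.equivOfCardEq (by simpa using hS)
  have hmem : ∀ b, s b ∈ S := fun b => hS1 (by simp)
  let ψ : A → S := fun a => if ha : a ∈ S then ⟨a, ha⟩ else ⟨s (g a), hmem _⟩
  have hψ : ∀ a, g (ψ a) = g a := by
    intro a
    by_cases ha : a ∈ S
    · simp [ψ, ha]
    · simp [ψ, ha, hs (g a)]
  refine ⟨e ∘ ψ, e.surjective.comp ?_, ?_⟩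
  · rintro ⟨a, ha⟩
    exact ⟨a, by simp [ψ, ha]⟩
  · intro a a' haa
    have : ψ a = ψ a' := e.injective haa
    rw [← hψ a, this, hψ]

lemma exists_thresh {X : Type} [MetricSpace X] [Fintype X] {s : ℝ} (hs : 0 < s) :
    ∃ t, 0 ≤ t ∧ t < s ∧ ∀ x y : X, dist x y < s → dist x y ≤ t := by
  classical
  let F : Finset ℝ := insert 0 ((Finset.univ.image (fun p : X × X => dist p.1 p.2)).filter (· < s))
  have hF : F.Nonempty := ⟨0, by simp [F]⟩
  refine ⟨F.max' hF, F.le_max' 0 (by simp [F]), ?_, ?_⟩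
  · rw [Finset.max'_lt_iff]
    intro y hy
    simp only [F, Finset.mem_insert, Finset.mem_filter] at hy
    rcases hy with rfl | hy
    · exact hs
    · exact hy.2
  · intro x y hxy
    apply F.le_max'
    simp only [F, Finset.mem_insert, Finset.mem_filter, Finset.mem_image, Finset.mem_univ, true_and]
    exact Or.inr ⟨⟨(x, y), rfl⟩, hxy⟩

lemma ghDist_le_of_surj {X Y : Type} [MetricSpace X] [Fintype X] [Nonempty X]
    [MetricSpace Y] [Fintype Y] [Nonempty Y] (f : X → Y) (hf : Function.Surjective f) {r : ℝ}
    (h : ∀ x x', |dist x x' - dist (f x) (f x')| ≤ r) : ghDist X Y ≤ r / 2 := by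
  have := ghDist_le_of_approx_subsets (X := X) (Y := Y) (s := Set.univ) (fun x => f x)
    (ε₁ := 0) (ε₂ := r) (ε₃ := 0) (fun x => ⟨x, trivial, by simp⟩)
    (fun y => by obtain ⟨x, rfl⟩ := hf y; exact ⟨⟨x, trivial⟩, by simp⟩)
    (fun x y => h x y)
  linarith

lemma ghDist_symm' (X Y : Type) [MetricSpace X] [Fintype X] [Nonempty X]
    [MetricSpace Y] [Fintype Y] [Nonempty Y] : ghDist X Y = ghDist Y X :=
  dist_comm (toGHSpace X) (toGHSpace Y)

lemma upper_part {X : Type} [MetricSpace X] [Fintype X] (h : Ultra X)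
    {D : Type} [Finite D] {l r : ℝ} (hr : 0 ≤ r) (hk : Nat.card D ≤ Fintype.card X)
    (hN : numCl X r ≤ Nat.card D)
    (hc : ∀ t, 0 ≤ t → t < l - r → Nat.card D ≤ numCl X t) :
    ∃ φ : X → D, Function.Surjective φ ∧ (∀ x y, φ x = φ y → dist x y ≤ r) ∧
      (∀ x y, φ x ≠ φ y → l - r ≤ dist x y) := by
  have key : ∃ t, 0 ≤ t ∧ t ≤ r ∧ Nat.card D ≤ numCl X t ∧
      ∀ x y : X, dist x y < l - r → dist x y ≤ t := by
    rcases le_or_gt (l - r) 0 with hs | hs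
    · exact ⟨0, le_rfl, hr, by rwa [numCl_zero h], fun x y hxy => by linarith⟩
    · obtain ⟨t, ht0, hts, ht⟩ := exists_thresh (X := X) hs
      rcases le_total t r with htr | htr
      · exact ⟨t, ht0, htr, hc t ht0 hts, ht⟩
      · refine ⟨r, hr, le_rfl, (hc t ht0 hts).trans (numCl_anti htr), fun x y hxy => ?_⟩
        have hcard : numCl X r = numCl X t :=
          le_antisymm (hN.trans (hc t ht0 hts)) (numCl_anti htr)
        let m : Quot (fun x y : X => dist x y ≤ r) → Quot (fun x y : X => dist x y ≤ t) :=
          Quot.map id (fun x y (hxy : dist x y ≤ r) => hxy.trans htr)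
        have hms : Function.Surjective m := by
          rintro ⟨x⟩
          exact ⟨Quot.mk _ x, rfl⟩
        have hmb : Function.Bijective m :=
          (Nat.bijective_iff_surjective_and_card m).mpr ⟨hms, hcard⟩
        rw [← quot_eq h hr]
        apply hmb.1
        exact (quot_eq h ht0 x y).mpr (ht x y hxy)
  obtain ⟨t, ht0, htr, hct, ht⟩ := key
  obtain ⟨φ, hφ, hφ'⟩ := exists_factor (D := D)
    (Quot.map id (fun x y (hxy : dist x y ≤ t) => hxy.trans htr) :
      Quot (fun x y : X => dist x y ≤ t) → Quot (fun x y : X => dist x y ≤ r))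
    (by rintro ⟨x⟩; exact ⟨Quot.mk _ x, rfl⟩) hN hct
  refine ⟨fun x => φ (Quot.mk _ x), hφ.comp Quot.mk_surjective, ?_, ?_⟩
  · intro x y hxy
    exact (quot_eq h hr x y).mp (hφ' _ _ hxy)
  · intro x y hxy
    by_contra hlt
    push Not at hlt
    apply hxy
    exact congrArg φ ((quot_eq h ht0 x y).mpr (ht x y hlt))

lemma gh_le_iff {X : Type} [MetricSpace X] [Fintype X] [Nonempty X] (h : Ultra X)
    {D : Type} [MetricSpace D] [Fintype D] [Nonempty D] {k : ℕ} {l r : ℝ} (hl : 0 ≤ l)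
    (hr : 0 ≤ r) (hD : IsSimplexOf D k l) :
    ghDist D X ≤ r / 2 ↔ Cond (numCl X) k l r := by
  obtain ⟨hk, hd⟩ := hD
  have hdle : ∀ a b : D, dist a b ≤ l := by
    intro a b
    by_cases hab : a = b
    · simpa [hab] using hl
    · exact (hd a b hab).le
  constructor
  · intro hgh
    have hcl : IsCompact (Set.range (optimalGHInjl D X)) :=
      isCompact_range (isometry_optimalGHInjl D X).continuous
    have hcr : IsCompact (Set.range (optimalGHInjr D X)) :=
      isCompact_range (isometry_optimalGHInjr D X).continuous
    have hfin : Metric.hausdorffEDist (Set.range (optimalGHInjl D X))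
        (Set.range (optimalGHInjr D X)) ≠ ⊤ :=
      Metric.hausdorffEDist_ne_top_of_nonempty_of_bounded (Set.range_nonempty _)
        (Set.range_nonempty _) hcl.isBounded hcr.isBounded
    have hH := hausdorffDist_optimal (X := D) (Y := X)
    have hf : ∀ a : D, ∃ x : X, dist (optimalGHInjl D X a) (optimalGHInjr D X x) ≤ r / 2 := by
      intro a
      obtain ⟨_, ⟨x, rfl⟩, hx⟩ := hcr.exists_infDist_eq_dist (Set.range_nonempty _)
        (optimalGHInjl D X a)
      refine ⟨x, ?_⟩
      rw [← hx]
      exact (Metric.infDist_le_hausdorffDist_of_mem (Set.mem_range_self a) hfin).trans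
        (hH.le.trans hgh)
    have hg : ∀ x : X, ∃ a : D, dist (optimalGHInjl D X a) (optimalGHInjr D X x) ≤ r / 2 := by
      intro x
      obtain ⟨_, ⟨a, rfl⟩, hx⟩ := hcl.exists_infDist_eq_dist (Set.range_nonempty _)
        (optimalGHInjr D X x)
      refine ⟨a, ?_⟩
      rw [dist_comm, ← hx]
      rw [Metric.hausdorffEDist_comm] at hfin
      rw [Metric.hausdorffDist_comm] at hH
      exact (Metric.infDist_le_hausdorffDist_of_mem (Set.mem_range_self x) hfin).trans
        (hH.le.trans hgh)
    have hdis : ∀ a b x y, dist (optimalGHInjl D X a) (optimalGHInjr D X x) ≤ r / 2 →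
        dist (optimalGHInjl D X b) (optimalGHInjr D X y) ≤ r / 2 →
        dist x y ≤ dist a b + r ∧ dist a b ≤ dist x y + r := by
      intro a b x y h1 h2
      rw [← (isometry_optimalGHInjl D X).dist_eq a b, ← (isometry_optimalGHInjr D X).dist_eq x y]
      generalize optimalGHInjl D X a = a' at *
      generalize optimalGHInjl D X b = b' at *
      generalize optimalGHInjr D X x = x' at *
      generalize optimalGHInjr D X y = y' at *
      have t1 := dist_triangle4 x' a' b' y'
      have t2 := dist_triangle4 a' x' y' b'
      rw [dist_comm x' a'] at t1
      rw [dist_comm y' b'] at t2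
      constructor <;> linarith
    choose f hf using hf
    choose g hg using hg
    refine ⟨?_, ?_, ?_⟩
    · rw [numCl_le_one h (by linarith)]
      intro x y
      have := (hdis _ _ _ _ (hg x) (hg y)).1
      linarith [hdle (g x) (g y)]
    · rw [← hk, ← Nat.card_eq_fintype_card]
      apply Nat.card_le_card_of_injective (fun q => g q.out)
      intro p q hpq
      rw [← Quot.out_eq p, ← Quot.out_eq q, quot_eq h hr]
      have := (hdis _ _ _ _ (hg p.out) (hg q.out)).1
      simp only at hpq
      rw [hpq, dist_self] at this
      linarith
    · intro t ht0 ht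
      rw [← hk, ← Nat.card_eq_fintype_card]
      apply Nat.card_le_card_of_injective (fun a => Quot.mk _ (f a))
      intro a b hab
      by_contra hne
      have h1 := (quot_eq h ht0 _ _).mp hab
      have := (hdis _ _ _ _ (hf a) (hf b)).2
      rw [hd a b hne] at this
      linarith
  · rintro ⟨h1, h2, h3⟩
    rw [numCl_le_one h (by linarith)] at h1
    rcases le_or_gt k (Fintype.card X) with hkm | hkm
    · have hkD : Nat.card D = k := by rw [Nat.card_eq_fintype_card, hk]
      obtain ⟨φ, hφ, ha, hb⟩ := upper_part (X := X) h (D := D) (l := l) hr (by rwa [hkD])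
        (by rwa [hkD]) (by rwa [hkD])
      rw [ghDist_symm']
      apply ghDist_le_of_surj φ hφ
      intro x y
      by_cases hxy : φ x = φ y
      · rw [hxy, dist_self, sub_zero, abs_of_nonneg dist_nonneg]
        exact ha x y hxy
      · rw [hd _ _ hxy, abs_le]
        constructor <;> linarith [hb x y hxy, h1 x y]
    · have hlr : l ≤ r := by
        by_contra hlt
        push Not at hlt
        have := h3 0 le_rfl (by linarith)
        rw [numCl_zero h] at this
        omega
      obtain ⟨g, hg⟩ : ∃ g : D → X, Function.Surjective g := by
        have : Nonempty (X ↪ D) := Function.Embedding.nonempty_of_card_le (by omega)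
        obtain ⟨e⟩ := this
        exact ⟨Function.invFun e, Function.invFun_surjective e.injective⟩
      apply ghDist_le_of_surj g hg
      intro a b
      by_cases hab : a = b
      · simp [hab, hr]
      · rw [hd a b hab, abs_le]
        constructor <;> linarith [h1 (g a) (g b), dist_nonneg (x := g a) (y := g b)]

lemma gh_eq_of_numCl {X Y : Type} [MetricSpace X] [Fintype X] [Nonempty X] (hX : Ultra X)
    [MetricSpace Y] [Fintype Y] [Nonempty Y] (hY : Ultra Y)
    (hN : ∀ t, 0 ≤ t → numCl X t = numCl Y t)
    {D : Type} [MetricSpace D] [Fintype D] [Nonempty D] {k : ℕ} {l : ℝ} (hl : 0 ≤ l)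
    (hD : IsSimplexOf D k l) : ghDist D X ≤ ghDist D Y := by
  have hg : 0 ≤ ghDist D Y := dist_nonneg (x := toGHSpace D) (y := toGHSpace Y)
  have h2 : 0 ≤ 2 * ghDist D Y := by linarith
  have := (gh_le_iff hY hl h2 hD).mp (by linarith)
  obtain ⟨a, b, c⟩ := this
  have := (gh_le_iff hX hl h2 hD).mpr
    ⟨by rwa [hN _ (by linarith)], by rwa [hN _ h2], fun t ht hlt => by rw [hN t ht]; exact c t ht hlt⟩
  linarith

/-- simplex with `k` points -/
def Spx (k : ℕ) (_l : ℝ) (_hl : 0 < _l) : Type := Fin k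

noncomputable instance (k : ℕ) (l : ℝ) (hl : 0 < l) : Fintype (Spx k l hl) :=
  inferInstanceAs (Fintype (Fin k))

noncomputable instance (k : ℕ) (l : ℝ) (hl : 0 < l) : DecidableEq (Spx k l hl) :=
  inferInstanceAs (DecidableEq (Fin k))

noncomputable instance (k : ℕ) (l : ℝ) (hl : 0 < l) : MetricSpace (Spx k l hl) where
  dist a b := if a = b then 0 else l
  dist_self a := by simp
  dist_comm a b := by simp [eq_comm]
  dist_triangle a b c := by
    show (if a = c then 0 else l) ≤ (if a = b then 0 else l) + (if b = c then 0 else l)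
    split_ifs with h1 h2 h3 <;> first | linarith | (subst_vars; contradiction)
  eq_of_dist_eq_zero {a b} hab := by
    by_contra hne
    change (if a = b then 0 else l) = 0 at hab
    rw [if_neg hne] at hab
    linarith

lemma numCl_le_of_gh {X Y : Type} [MetricSpace X] [Fintype X] [Nonempty X] (hX : Ultra X)
    [MetricSpace Y] [Fintype Y] [Nonempty Y] (hY : Ultra Y)
    (H : ∀ (n : ℕ), 1 ≤ n → ∀ (l : ℝ), 0 ≤ l →
      ∀ (Δ : Type) (_ : MetricSpace Δ) (_ : Fintype Δ) (_ : Nonempty Δ),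
        IsSimplexOf Δ n l → GromovHausdorff.ghDist Δ X = GromovHausdorff.ghDist Δ Y)
    (t : ℝ) (ht : 0 ≤ t) : numCl X t ≤ numCl Y t := by
  classical
  set k := numCl X t with hk
  -- a threshold strictly above `t`
  obtain ⟨s, hts, hs⟩ : ∃ s, t < s ∧ ∀ x y : X, dist x y < s → dist x y ≤ t := by
    let F : Finset ℝ :=
      insert (t + 1) ((Finset.univ.image (fun p : X × X => dist p.1 p.2)).filter (t < ·))
    have hF : F.Nonempty := ⟨t + 1, by simp [F]⟩
    refine ⟨F.min' hF, ?_, ?_⟩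
    · rw [Finset.lt_min'_iff]
      intro y hy
      simp only [F, Finset.mem_insert, Finset.mem_filter] at hy
      rcases hy with rfl | hy
      · linarith
      · exact hy.2
    · intro x y hxy
      by_contra hlt
      push Not at hlt
      have : F.min' hF ≤ dist x y := by
        apply F.min'_le
        simp only [F, Finset.mem_insert, Finset.mem_filter, Finset.mem_image, Finset.mem_univ,
          true_and]
        exact Or.inr ⟨⟨(x, y), rfl⟩, hlt⟩
      linarith
  have hdx : ∀ x y : X, dist x y ≤ Metric.diam (Set.univ : Set X) := fun x y =>
    Metric.dist_le_diam_of_mem (Set.toFinite _).isBounded trivial trivial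
  have hd0 : 0 ≤ Metric.diam (Set.univ : Set X) := Metric.diam_nonneg
  set d := Metric.diam (Set.univ : Set X)
  have hl : 0 < s + d := by linarith
  have hk1 : 1 ≤ k := numCl_pos t
  have hne : Nonempty (Spx k (s + d) hl) := ⟨(⟨0, hk1⟩ : Fin k)⟩
  have hS : IsSimplexOf (Spx k (s + d) hl) k (s + d) :=
    ⟨Fintype.card_fin k, fun a b hab => if_neg hab⟩
  have hgh := H k hk1 (s + d) hl.le (Spx k (s + d) hl) _ _ hne hS
  have hcX : Cond (numCl X) k (s + d) d := by
    refine ⟨?_, ?_, ?_⟩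
    · rw [numCl_le_one hX (by linarith)]
      intro x y
      linarith [hdx x y]
    · exact ((numCl_le_one hX hd0).mpr hdx).trans hk1
    · intro t' ht' hlt
      rcases le_total t' t with hle | hle
      · exact numCl_anti hle
      · rw [hk]
        apply Nat.card_le_card_of_surjective
          (Quot.map id (fun x y (hxy : dist x y ≤ t') => hs x y (by linarith)))
        rintro ⟨x⟩
        exact ⟨Quot.mk _ x, rfl⟩
  have hcY := (gh_le_iff hY hl.le hd0 hS).mp (hgh ▸ (gh_le_iff hX hl.le hd0 hS).mpr hcX)
  exact hcY.2.2 t ht (by linarith)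

end Helpers

section Trees

open SimpleGraph

lemma reach_sup_edge {V : Type} (G : SimpleGraph V) (u v x y : V)
    (h : (G ⊔ edge u v).Reachable x y) :
    G.Reachable x y ∨ (G.Reachable x u ∧ G.Reachable v y) ∨
      (G.Reachable x v ∧ G.Reachable u y) := by
  obtain ⟨p⟩ := h
  induction p with
  | nil => exact Or.inl (Reachable.refl _)
  | @cons a b c hab p ih =>
    rw [sup_adj, edge_adj] at hab
    rcases hab with hab | ⟨⟨rfl, rfl⟩ | ⟨rfl, rfl⟩, -⟩
    · rcases ih with ih | ⟨h1, h2⟩ | ⟨h1, h2⟩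
      · exact Or.inl (hab.reachable.trans ih)
      · exact Or.inr (Or.inl ⟨hab.reachable.trans h1, h2⟩)
      · exact Or.inr (Or.inr ⟨hab.reachable.trans h1, h2⟩)
    · rcases ih with ih | ⟨h1, h2⟩ | ⟨h1, h2⟩
      · exact Or.inr (Or.inl ⟨Reachable.refl _, ih⟩)
      · exact Or.inr (Or.inl ⟨Reachable.refl _, h2⟩)
      · exact Or.inl h2
    · rcases ih with ih | ⟨h1, h2⟩ | ⟨h1, h2⟩
      · exact Or.inr (Or.inr ⟨Reachable.refl _, ih⟩)
      · exact Or.inl h2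
      · exact Or.inr (Or.inr ⟨Reachable.refl _, h2⟩)

lemma card_comp_sup_edge {V : Type} [Fintype V] (G : SimpleGraph V) (u v : V)
    (h : ¬ G.Reachable u v) :
    Nat.card (G ⊔ edge u v).ConnectedComponent + 1 = Nat.card G.ConnectedComponent := by
  classical
  have hne : G.connectedComponentMk v ≠ G.connectedComponentMk u := by
    intro he
    exact h (ConnectedComponent.exact he).symm
  let f : {c : G.ConnectedComponent // c ≠ G.connectedComponentMk v} →
      (G ⊔ edge u v).ConnectedComponent :=
    fun c => c.1.map (Hom.ofLE le_sup_left)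
  have huv : u ≠ v := fun he => h (he ▸ Reachable.refl _)
  have huv' : (G ⊔ edge u v).Reachable u v := by
    apply Adj.reachable
    rw [sup_adj, edge_adj]
    exact Or.inr ⟨Or.inl ⟨rfl, rfl⟩, huv⟩
  have hf : Function.Bijective f := by
    constructor
    · rintro ⟨c, hc⟩ ⟨c', hc'⟩ hcc
      induction c using ConnectedComponent.ind with | _ x =>
      induction c' using ConnectedComponent.ind with | _ y =>
      have hr : (G ⊔ edge u v).Reachable x y := ConnectedComponent.exact hcc
      have hx : ¬ G.Reachable x v := fun hh => hc (ConnectedComponent.sound hh)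
      have hy : ¬ G.Reachable y v := fun hh => hc' (ConnectedComponent.sound hh)
      rcases reach_sup_edge G u v x y hr with hh | ⟨-, hh⟩ | ⟨hh, -⟩
      · exact Subtype.ext (ConnectedComponent.sound hh)
      · exact (hy hh.symm).elim
      · exact (hx hh).elim
    · intro c
      induction c using ConnectedComponent.ind with | _ x =>
      by_cases hx : G.connectedComponentMk x = G.connectedComponentMk v
      · refine ⟨⟨G.connectedComponentMk u, hne.symm⟩, ?_⟩
        exact ConnectedComponent.sound
          (huv'.trans ((ConnectedComponent.exact hx).symm.mono le_sup_left))
      · exact ⟨⟨_, hx⟩, rfl⟩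
  rw [← Nat.card_eq_of_bijective f hf]
  have := Fintype.ofFinite G.ConnectedComponent
  rw [Nat.card_eq_fintype_card, Nat.card_eq_fintype_card, Fintype.card_subtype_compl,
    Fintype.card_subtype_eq]
  have : 0 < Fintype.card G.ConnectedComponent := Fintype.card_pos_iff.mpr ⟨G.connectedComponentMk v⟩
  omega

lemma forest_card {V : Type} [Fintype V] (n : ℕ) : ∀ G : SimpleGraph V, G.IsAcyclic →
    G.edgeSet.ncard = n → n + Nat.card G.ConnectedComponent = Fintype.card V := by
  classical
  induction n with
  | zero =>
    intro G _ hG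
    rw [Set.ncard_eq_zero, edgeSet_eq_empty] at hG
    subst hG
    rw [zero_add, ← Nat.card_eq_fintype_card]
    symm
    apply Nat.card_eq_of_bijective (fun v => (⊥ : SimpleGraph V).connectedComponentMk v)
    refine ⟨fun x y hxy => ?_, fun c => ?_⟩
    · exact reachable_bot.mp (ConnectedComponent.exact hxy)
    · induction c using ConnectedComponent.ind with | _ x => exact ⟨x, rfl⟩
  | succ n ih =>
    intro G hG hn
    have hne : G.edgeSet.Nonempty := by
      rw [← Set.ncard_pos]; omega
    obtain ⟨e, he⟩ := hne
    induction e with | _ u v =>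
    have hb := isAcyclic_iff_forall_isBridge.mp hG he
    rw [isBridge_iff] at hb
    have hadj : G.Adj u v := he
    have hG' : G.deleteEdges {s(u, v)} ⊔ edge u v = G := by
      ext x y
      rw [sup_adj, edge_adj, deleteEdges_adj]
      simp only [Set.mem_singleton_iff, Sym2.eq_iff]
      constructor
      · rintro (h | ⟨⟨rfl, rfl⟩ | ⟨rfl, rfl⟩, -⟩)
        · exact h.1
        · exact hadj
        · exact hadj.symm
      · intro h
        have := h.ne
        tauto
    have h1 := ih (G.deleteEdges {s(u, v)}) (hG.anti (deleteEdges_le _)) (by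
      rw [edgeSet_deleteEdges, Set.ncard_sdiff_singleton_of_mem he, hn]; rfl)
    have h2 := card_comp_sup_edge _ _ _ hb
    rw [hG'] at h2
    omega

/-- length of an unordered pair -/
noncomputable def elen {V : Type} [MetricSpace V] : Sym2 V → ℝ :=
  Sym2.lift ⟨fun x y => dist x y, fun _ _ => dist_comm _ _⟩

lemma elen_mk {V : Type} [MetricSpace V] (x y : V) : elen s(x, y) = dist x y := rfl

lemma graphLength_eq {V : Type} [MetricSpace V] [Fintype V] (G : SimpleGraph V) :
    graphLength G = ∑ e ∈ G.edgeSet.toFinite.toFinset, elen e := rfl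

lemma mst_reach {V : Type} [MetricSpace V] [Fintype V] {T : SimpleGraph V} (hT : IsMST T)
    {t : ℝ} {x y : V} (hxy : dist x y ≤ t) :
    (T.deleteEdges {e | t < elen e}).Reachable x y := by
  classical
  by_contra hcon
  obtain ⟨hT, hmin⟩ := hT
  obtain ⟨p, hp⟩ := hT.connected.exists_isPath x y
  obtain ⟨e, het, hep⟩ := p.exists_mem_edges_of_not_reachable_deleteEdges hcon
  have heT : e ∈ T.edgeSet := p.edges_subset_edgeSet hep
  have hnr : ¬ (T.deleteEdges {e}).Reachable x y := by
    intro hr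
    obtain ⟨q, hq⟩ := hr.exists_isPath
    have := hT.isAcyclic.path_unique ⟨p, hp⟩ ⟨q.mapLe (deleteEdges_le _), hq.mapLe _⟩
    have h2 : p = q.mapLe (deleteEdges_le _) := congrArg Subtype.val this
    rw [h2, Walk.edges_mapLe_eq_edges] at hep
    have := q.edges_subset_edgeSet hep
    rw [edgeSet_deleteEdges] at this
    exact this.2 rfl
  have hne : x ≠ y := fun he => hnr (he ▸ Reachable.refl _)
  have hac : (T.deleteEdges {e} ⊔ edge x y).IsAcyclic :=
    IsAcyclic.sup_edge_of_not_reachable hnr (hT.isAcyclic.anti (deleteEdges_le _))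
  have hnin : s(x, y) ∉ T.edgeSet \ {e} := by
    intro hin
    rw [← edgeSet_deleteEdges] at hin
    exact hnr (Adj.reachable hin)
  have hset : (T.deleteEdges {e} ⊔ edge x y).edgeSet = insert s(x, y) (T.edgeSet \ {e}) := by
    rw [edgeSet_sup, edgeSet_deleteEdges, edgeSet_edge_of_ne hne, Set.union_comm]
    rfl
  have htree : (T.deleteEdges {e} ⊔ edge x y).IsTree := by
    have h1 := forest_card _ _ hac rfl
    have h2 := forest_card _ _ hT.isAcyclic rfl
    rw [hset, Set.ncard_insert_of_notMem hnin, Set.ncard_sdiff_singleton_add_one heT] at h1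
    have h3 : Nat.card (T.deleteEdges {e} ⊔ edge x y).ConnectedComponent
      = Nat.card T.ConnectedComponent := by omega
    have h4 : Nat.card T.ConnectedComponent ≤ 1 := by
      rw [Finite.card_le_one_iff_subsingleton]
      exact hT.connected.preconnected.subsingleton_connectedComponent
    rw [← h3, Finite.card_le_one_iff_subsingleton] at h4
    have := hT.connected.nonempty
    exact ⟨⟨fun a b => ConnectedComponent.exact (Subsingleton.elim _ _)⟩, hac⟩
  have hlen := hmin _ htree
  rw [graphLength_eq, graphLength_eq] at hlen
  have hfs : (T.deleteEdges {e} ⊔ edge x y).edgeSet.toFinite.toFinset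
      = insert s(x, y) (T.edgeSet.toFinite.toFinset.erase e) := by
    ext a
    simp only [Set.Finite.mem_toFinset, hset, Finset.mem_insert, Finset.mem_erase,
      Set.mem_insert_iff, Set.mem_sdiff, Set.mem_singleton_iff]
    tauto
  rw [hfs, Finset.sum_insert (by
    simp only [Set.Finite.mem_toFinset, Finset.mem_erase]
    intro hh
    exact hnin ⟨hh.2, hh.1⟩)] at hlen
  have hsum := Finset.sum_erase_add (T.edgeSet.toFinite.toFinset) elen
    (a := e) (by simpa using heT)
  have : t < elen e := het
  rw [elen_mk] at hlen
  linarith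

lemma countP_add {V : Type} [MetricSpace V] [Fintype V] (hV : Ultra V) {T : SimpleGraph V}
    (hT : IsMST T) {t : ℝ} (ht : 0 ≤ t) :
    ((edgeLengths T).filter (· ≤ t)).card + numCl V t = Fintype.card V := by
  classical
  have h1 := forest_card _ (T.deleteEdges {e | t < elen e})
    (hT.1.isAcyclic.anti (deleteEdges_le _)) rfl
  have hr : (T.deleteEdges {e | t < elen e}).Reachable =
      fun x y : V => Dist.dist x y ≤ t := by
    ext x y
    constructor
    · rintro ⟨p⟩
      induction p with
      | nil => simpa using ht
      | @cons a b c hab p ih =>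
        rw [deleteEdges_adj] at hab
        have : dist a b ≤ t := by
          have := hab.2
          simpa [elen_mk] using this
        exact (hV a b c).trans (max_le this ih)
    · exact mst_reach hT
  have h2 : Nat.card (T.deleteEdges {e | t < elen e}).ConnectedComponent = numCl V t := by
    unfold numCl ConnectedComponent
    rw [hr]
  rw [h2] at h1
  rw [← h1]
  congr 1
  unfold edgeLengths
  rw [Multiset.filter_map, Multiset.card_map]
  rw [Set.ncard_eq_toFinset_card _ (Set.toFinite _)]
  rw [← Finset.filter_val]
  change Finset.card _ = _
  congr 1
  ext e
  simp only [Finset.mem_filter, Set.Finite.mem_toFinset, edgeSet_deleteEdges, Set.mem_sdiff,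
    Set.mem_setOf_eq, not_lt]
  rfl

lemma edgeLengths_pos {V : Type} [MetricSpace V] [Fintype V] (T : SimpleGraph V) :
    ∀ a ∈ edgeLengths T, 0 < a := by
  intro a ha
  unfold edgeLengths at ha
  rw [Multiset.mem_map] at ha
  obtain ⟨e, he, rfl⟩ := ha
  have he : e ∈ T.edgeSet := by simpa using he
  induction e with | _ u v =>
  exact dist_pos.mpr (Adj.ne he)

lemma multiset_ext_le (S S' : Multiset ℝ) (hS : ∀ a ∈ S, 0 < a) (hS' : ∀ a ∈ S', 0 < a)
    (h : ∀ t, 0 ≤ t → (S.filter (· ≤ t)).card = (S'.filter (· ≤ t)).card) : S = S' := by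
  classical
  ext a
  rcases le_or_gt a 0 with ha | ha
  · rw [Multiset.count_eq_zero_of_notMem fun hh => absurd (hS a hh) ha.not_gt,
      Multiset.count_eq_zero_of_notMem fun hh => absurd (hS' a hh) ha.not_gt]
  · obtain ⟨t, ht0, hta, ht⟩ : ∃ t, 0 ≤ t ∧ t < a ∧ ∀ b ∈ S + S', b < a → b ≤ t := by
      let F : Finset ℝ := insert 0 ((S + S').toFinset.filter (· < a))
      have hF : F.Nonempty := ⟨0, by simp [F]⟩
      refine ⟨F.max' hF, F.le_max' 0 (by simp [F]), ?_, ?_⟩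
      · rw [Finset.max'_lt_iff]
        intro y hy
        simp only [F, Finset.mem_insert, Finset.mem_filter] at hy
        rcases hy with rfl | hy
        · exact ha
        · exact hy.2
      · intro b hb hba
        apply F.le_max'
        simp only [F, Finset.mem_insert, Finset.mem_filter, Multiset.mem_toFinset]
        exact Or.inr ⟨hb, hba⟩
    have key : ∀ M : Multiset ℝ, (∀ b ∈ M, b < a → b ≤ t) →
        (M.filter (· ≤ a)).card = (M.filter (· ≤ t)).card + M.count a := by
      intro M
      induction M using Multiset.induction_on with
      | empty => simp
      | cons b M ih =>
        intro hM
        have := ih fun c hc => hM c (Multiset.mem_cons_of_mem hc)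
        have hb := hM b (Multiset.mem_cons_self _ _)
        rw [Multiset.count_cons]
        rw [Multiset.filter_cons, Multiset.filter_cons, Multiset.card_add, Multiset.card_add]
        rcases lt_trichotomy b a with h1 | h1 | h1
        · rw [if_pos h1.le, if_pos (hb h1), if_neg h1.ne']
          omega
        · rw [if_pos h1.le, if_neg (by linarith), if_pos h1.symm, Multiset.card_singleton,
            Multiset.card_zero]
          omega
        · rw [if_neg (by linarith), if_neg (by linarith), if_neg h1.ne]
          omega
    have k1 := key S fun b hb => ht b (Multiset.mem_add.mpr (Or.inl hb))
    have k2 := key S' fun b hb => ht b (Multiset.mem_add.mpr (Or.inr hb))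
    have := h a ha.le
    have := h t ht0
    omega

end Trees


/-- Two finite ultrametric spaces `X` and `Y` are indistinguishable (the Gromov–Hausdorff
distances from them to every simplex `lΔₙ`, `n ≥ 1`, `l ≥ 0`, coincide) if and only if
`#X = #Y` and their mst-spectra coincide (the descending vectors of edge lengths of
minimal spanning trees on `X` and `Y` are equal). -/
theorem ultrametric_indistinguishable_iff (X Y : Type) [MetricSpace X] [Fintype X]
    [Nonempty X] [MetricSpace Y] [Fintype Y] [Nonempty Y]
    (hXu : ∀ x y z : X, dist x z ≤ max (dist x y) (dist y z))
    (hYu : ∀ x y z : Y, dist x z ≤ max (dist x y) (dist y z))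
    (T_X : SimpleGraph X) (hTX : IsMST T_X) (T_Y : SimpleGraph Y) (hTY : IsMST T_Y) :
    (∀ (n : ℕ), 1 ≤ n → ∀ (l : ℝ), 0 ≤ l →
      ∀ (Δ : Type) (_ : MetricSpace Δ) (_ : Fintype Δ) (_ : Nonempty Δ),
        IsSimplexOf Δ n l → GromovHausdorff.ghDist Δ X = GromovHausdorff.ghDist Δ Y) ↔
    (Fintype.card X = Fintype.card Y ∧
      (edgeLengths T_X).sort (· ≥ ·) = (edgeLengths T_Y).sort (· ≥ ·)) := by
  constructor
  · intro H
    have hN : ∀ t, 0 ≤ t → numCl X t = numCl Y t := fun t ht =>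
      le_antisymm (numCl_le_of_gh hXu hYu H t ht)
        (numCl_le_of_gh hYu hXu (fun n hn l hl D i1 i2 i3 hD => (H n hn l hl D i1 i2 i3 hD).symm)
          t ht)
    have hc : Fintype.card X = Fintype.card Y := by
      rw [← numCl_zero hXu, ← numCl_zero hYu, hN 0 le_rfl]
    refine ⟨hc, ?_⟩
    rw [multiset_ext_le (edgeLengths T_X) (edgeLengths T_Y) (edgeLengths_pos _)
      (edgeLengths_pos _)]
    intro t ht
    have h1 := countP_add hXu hTX ht
    have h2 := countP_add hYu hTY ht
    have h3 := hN t ht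
    omega
  · rintro ⟨hc, hs⟩ n hn l hl D i1 i2 i3 hD
    have hs' : edgeLengths T_X = edgeLengths T_Y := by
      rw [← Multiset.sort_eq (edgeLengths T_X) (· ≥ ·), hs, Multiset.sort_eq]
    have hN : ∀ t, 0 ≤ t → numCl X t = numCl Y t := by
      intro t ht
      have h1 := countP_add hXu hTX ht
      have h2 := countP_add hYu hTY ht
      rw [hs'] at h1
      omega
    exact le_antisymm (gh_eq_of_numCl hXu hYu hN hl hD)
      (gh_eq_of_numCl hYu hXu (fun t ht => (hN t ht).symm) hl hD)
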